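/- arXiv:0901.0947 — 2 statements merged into one kernel-verified Lean document; each statement's English description precedes it below -/
import Mathlib

section
/- With R = (qκ1-κ2)(-aq² + bq - q(qκ1-κ2)y) - q²γ, one has the identity ξ y R = q·T, i.e. ξ y R = -qκ1κ2² ξ² (y-c3)(y-c4) + ξ(2q²κ1κ2 y² - q²κ1κ2σ1 y + q(q²κ1θ1+κ2θ2)) - q³κ1 (y-c1)(y-c2). -/
/-- With `R = (qκ1-κ2)(-aq² + bq - q(qκ1-κ2)y) - q²γ`, one has `ξ y R = q T`, i.e.
`ξ y R = -qκ1κ2² ξ² (y-c3)(y-c4) + ξ(2q²κ1κ2 y² - q²κ1κ2σ1 y + q(q²κ1θ1+κ2θ2))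
  - q³κ1 (y-c1)(y-c2)`. -/
theorem xi_y_R_eq_q_T
    (q κ1 κ2 θ1 θ2 c1 c2 c3 c4 : ℂ)
    (hq : q ≠ 0) (hκ1 : κ1 ≠ 0) (hκ2 : κ2 ≠ 0) (hθ1 : θ1 ≠ 0) (hθ2 : θ2 ≠ 0)
    (hc1 : c1 ≠ 0) (hc2 : c2 ≠ 0) (hc3 : c3 ≠ 0) (hc4 : c4 ≠ 0)
    (hrel : κ1 * κ2 * c1 * c2 * c3 * c4 = θ1 * θ2)
    (σ1 σ3 : ℂ)
    (hσ1 : σ1 = c1 + c2 + c3 + c4)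
    (hσ3 : σ3 = c1 * c2 * c3 + c1 * c2 * c4 + c1 * c3 * c4 + c2 * c3 * c4)
    (y ξ : ℂ) (hy : y ≠ 0) (hξ : ξ ≠ 0)
    (a b β γ R : ℂ)
    (ha : a = -κ1 * y + (y - c1) * (y - c2) / (y * ξ) - θ1 / y)
    (hb : b = -κ2 * y + κ1 * κ2 * ξ * (y - c3) * (y - c4) / y - θ2 / y)
    (hβ : β = -(κ1 * κ2 * σ3 + θ1 * b + θ2 * a) / y)
    (hγ : γ = κ1 * b + κ2 * a + κ1 * κ2 * σ1)
    (hR : R = (q * κ1 - κ2) * (-a * q ^ 2 + b * q - q * (q * κ1 - κ2) * y) - q ^ 2 * γ) :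
    ξ * y * R
      = -q * κ1 * κ2 ^ 2 * ξ ^ 2 * (y - c3) * (y - c4)
        + ξ * (2 * q ^ 2 * κ1 * κ2 * y ^ 2 - q ^ 2 * κ1 * κ2 * σ1 * y
          + q * (q ^ 2 * κ1 * θ1 + κ2 * θ2))
        - q ^ 3 * κ1 * (y - c1) * (y - c2) := by
  have h1 : ξ * y * a = -κ1 * y ^ 2 * ξ + (y - c1) * (y - c2) - θ1 * ξ := by
    rw [ha]; field_simp
  have h2 : y * b = -κ2 * y ^ 2 + κ1 * κ2 * ξ * (y - c3) * (y - c4) - θ2 := by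
    rw [hb]; field_simp
  rw [hR, hγ]
  linear_combination (-q ^ 3 * κ1) * h1 + (-q * κ2 * ξ) * h2
end

section
/- One has the factorization S - c1·y·T = (ξ(c1κ2y - qθ1) - qc1(y - c2)) · (κ1κ2 ξ (y-c3)(y-c4) - (1/c1)(qc1κ1y - θ2)(y - c1)) as an identity of complex numbers (equivalently, of rational functions of y and ξ). -/
/-- Factorization of `S - c1 y T`:
`S - c1 y T = (ξ(c1κ2y - qθ1) - qc1(y - c2)) ·
  (κ1κ2 ξ (y-c3)(y-c4) - (1/c1)(qc1κ1y - θ2)(y - c1))`. -/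
theorem S_sub_c1_y_T_factorization
    (q κ1 κ2 θ1 θ2 c1 c2 c3 c4 : ℂ)
    (hq : q ≠ 0) (hκ1 : κ1 ≠ 0) (hκ2 : κ2 ≠ 0) (hθ1 : θ1 ≠ 0) (hθ2 : θ2 ≠ 0)
    (hc1 : c1 ≠ 0) (hc2 : c2 ≠ 0) (hc3 : c3 ≠ 0) (hc4 : c4 ≠ 0)
    (hrel : κ1 * κ2 * c1 * c2 * c3 * c4 = θ1 * θ2)
    (σ1 σ3 : ℂ)
    (hσ1 : σ1 = c1 + c2 + c3 + c4)
    (hσ3 : σ3 = c1 * c2 * c3 + c1 * c2 * c4 + c1 * c3 * c4 + c2 * c3 * c4)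
    (y ξ : ℂ) (hy : y ≠ 0) (hξ : ξ ≠ 0)
    (S T : ℂ)
    (hS : S = -q * κ1 * κ2 * θ1 * ξ ^ 2 * (y - c3) * (y - c4)
      + ξ * ((q ^ 2 * κ1 * θ1 + κ2 * θ2) * y ^ 2 - q * κ1 * κ2 * σ3 * y
        + 2 * q * θ1 * θ2)
      - q * θ2 * (y - c1) * (y - c2))
    (hT : T = -κ1 * κ2 ^ 2 * ξ ^ 2 * (y - c3) * (y - c4)
      + ξ * (2 * q * κ1 * κ2 * y ^ 2 - q * κ1 * κ2 * σ1 * y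
        + (q ^ 2 * κ1 * θ1 + κ2 * θ2))
      - q ^ 2 * κ1 * (y - c1) * (y - c2)) :
    S - c1 * y * T
      = (ξ * (c1 * κ2 * y - q * θ1) - q * c1 * (y - c2)) *
        (κ1 * κ2 * ξ * (y - c3) * (y - c4)
          - (1 / c1) * (q * c1 * κ1 * y - θ2) * (y - c1)) := by
  subst hS hT hσ1 hσ3
  have h : c1 * (1 / c1) = 1 := by field_simp
  apply mul_left_cancel₀ hc1
  generalize 1 / c1 = d at h
  linear_combination (-q * ξ * (c1 + y)) * hrel + (ξ * (c1 * κ2 * y - q * θ1) - q * c1 * (y - c2)) * (q * c1 * κ1 * y - θ2) * (y - c1) * h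
end
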